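/- Let E = (H, a, b, λ, μ) be the harmonic decomposition of an elasticity tensor, where H is represented by a harmonic homogeneous degree-4 polynomial p in three real variables (Δp = 0), a and b are traceless real symmetric 3×3 matrices, and λ, μ are real scalars. Then E is cubic — i.e. the joint stabilizer {g ∈ SO(3) : g ⋆ p = p, g a gᵀ = a, g b gᵀ = b} is conjugate in SO(3) to the octahedral group 𝕆 — if and only if a = 0, b = 0, the deviatoric part of d₂(p) vanishes (d₂(p) is a scalar multiple of the identity), and d₂(p) ≠ 0; here d₂(p) is the symmetric matrix with entries d₂(p)ᵢⱼ = Σ_{k,l,m} (∂ₖ∂ₗ∂ₘ∂ᵢ p)·(∂ₖ∂ₗ∂ₘ∂ⱼ p), realizing d₂ = tr₁₃(H²) up to a positive factor. -/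

import Mathlib

open Matrix MvPolynomial

/-- The rotation group `SO(3)` as a set of real `3 × 3` matrices. -/
def SO3 : Set (Matrix (Fin 3) (Fin 3) ℝ) := {g | g * gᵀ = 1 ∧ g.det = 1}

/-- The octahedral subgroup `𝕆` of `SO(3)`: rotations sending each standard basis vector
to `±` a standard basis vector. -/
def Octa : Set (Matrix (Fin 3) (Fin 3) ℝ) :=
  {g | g ∈ SO3 ∧ ∀ i : Fin 3, ∃ j : Fin 3,
    g.mulVec (Pi.single i 1) = Pi.single j 1 ∨ g.mulVec (Pi.single i 1) = -Pi.single j 1}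

/-- The Laplacian of a polynomial in three variables. -/
noncomputable def lap (p : MvPolynomial (Fin 3) ℝ) : MvPolynomial (Fin 3) ℝ :=
  ∑ i, pderiv i (pderiv i p)

/-- `g ∈ SO(3)` fixes the polynomial `q`, i.e. `q(g⁻¹·x) = q(x)` for all `x`. -/
def fixesPoly (g : Matrix (Fin 3) (Fin 3) ℝ) (q : MvPolynomial (Fin 3) ℝ) : Prop :=
  ∀ x : Fin 3 → ℝ, eval (g⁻¹.mulVec x) q = eval x q

/-- The symmetric matrix `d₂(p)ᵢⱼ = Σ_{k,l,m} (∂ₖ∂ₗ∂ₘ∂ᵢ p)·(∂ₖ∂ₗ∂ₘ∂ⱼ p)`, realizing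
`d₂ = tr₁₃(H²)` up to a positive factor. -/
noncomputable def d2 (p : MvPolynomial (Fin 3) ℝ) : Matrix (Fin 3) (Fin 3) ℝ :=
  Matrix.of fun i j => ∑ k, ∑ l, ∑ m,
    (eval 0 (pderiv k (pderiv l (pderiv m (pderiv i p))))) *
    (eval 0 (pderiv k (pderiv l (pderiv m (pderiv j p)))))

/-- Fourth order tensors on `ℝ³`, given by their components. -/
abbrev Tensor4 := Fin 3 → Fin 3 → Fin 3 → Fin 3 → ℝ

namespace Tensor4

/-- Total symmetry, expressed on the adjacent transpositions of the indices. -/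
structure IsSymm (H : Tensor4) : Prop where
  swap₁ : ∀ i j k l, H i j k l = H j i k l
  swap₂ : ∀ i j k l, H i j k l = H i k j l
  swap₃ : ∀ i j k l, H i j k l = H i j l k

/-- Vanishing of the trace over the first two indices. -/
def IsTraceless (H : Tensor4) : Prop := ∀ k l, ∑ i, H i i k l = 0

/-- The quartic form attached to a fourth order tensor. -/
def form (H : Tensor4) (x : Fin 3 → ℝ) : ℝ :=
  ∑ i, ∑ j, ∑ k, ∑ l, H i j k l * (x i * x j * x k * x l)

/-- The action of a matrix on fourth order tensors. -/
def rot (g : Matrix (Fin 3) (Fin 3) ℝ) (H : Tensor4) : Tensor4 := fun i j k l =>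
  ∑ a, ∑ b, ∑ c, ∑ d, g i a * g j b * g k c * g l d * H a b c d

/-- The quadratic covariant `Σ_{k,l,m} H_{klmi} H_{klmj}`. -/
def gram (H : Tensor4) : Matrix (Fin 3) (Fin 3) ℝ :=
  Matrix.of fun i j => ∑ k, ∑ l, ∑ m, H k l m i * H k l m j

lemma sum_comm_four (f : Fin 3 → Fin 3 → Fin 3 → Fin 3 → Fin 3 → Fin 3 → Fin 3 → Fin 3 → ℝ) :
    ∑ i, ∑ j, ∑ k, ∑ l, ∑ a, ∑ b, ∑ c, ∑ d, f i j k l a b c d =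
      ∑ a, ∑ b, ∑ c, ∑ d, ∑ i, ∑ j, ∑ k, ∑ l, f i j k l a b c d := by
  have e : ∀ F : Fin 3 → Fin 3 → Fin 3 → Fin 3 → ℝ,
      ∑ i, ∑ j, ∑ k, ∑ l, F i j k l =
        ∑ t : Fin 3 × Fin 3 × Fin 3 × Fin 3, F t.1 t.2.1 t.2.2.1 t.2.2.2 := fun F => by
    simp only [Fintype.sum_prod_type]
  simp only [e]
  exact Finset.sum_comm

lemma form_rot (g : Matrix (Fin 3) (Fin 3) ℝ) (H : Tensor4) (x : Fin 3 → ℝ) :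
    form (rot g H) x = form H (gᵀ *ᵥ x) := by
  unfold form rot
  simp only [Finset.sum_mul]
  rw [sum_comm_four]
  refine Finset.sum_congr rfl fun a _ => Finset.sum_congr rfl fun b _ =>
    Finset.sum_congr rfl fun c _ => Finset.sum_congr rfl fun d _ => ?_
  simp only [Matrix.mulVec, dotProduct, Matrix.transpose_apply, Fin.sum_univ_three]
  ring

lemma IsSymm.sort_eq {H : Tensor4} (hH : H.IsSymm) :
    ((∀ k l, H 1 0 k l = H 0 1 k l) ∧ (∀ k l, H 2 0 k l = H 0 2 k l) ∧
      ∀ k l, H 2 1 k l = H 1 2 k l) ∧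
    ((∀ i l, H i 1 0 l = H i 0 1 l) ∧ (∀ i l, H i 2 0 l = H i 0 2 l) ∧
      ∀ i l, H i 2 1 l = H i 1 2 l) ∧
    (∀ i j, H i j 1 0 = H i j 0 1) ∧ (∀ i j, H i j 2 0 = H i j 0 2) ∧
      ∀ i j, H i j 2 1 = H i j 1 2 :=
  ⟨⟨fun _ _ => hH.swap₁ .., fun _ _ => hH.swap₁ .., fun _ _ => hH.swap₁ ..⟩,
    ⟨fun _ _ => hH.swap₂ .., fun _ _ => hH.swap₂ .., fun _ _ => hH.swap₂ ..⟩,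
    fun _ _ => hH.swap₃ .., fun _ _ => hH.swap₃ .., fun _ _ => hH.swap₃ ..⟩

lemma IsSymm.form_eq {H : Tensor4} (hH : H.IsSymm) (x : Fin 3 → ℝ) :
    form H x = H 0 0 0 0 * x 0 ^ 4 + H 1 1 1 1 * x 1 ^ 4 + H 2 2 2 2 * x 2 ^ 4 +
      4 * (H 0 0 0 1 * x 0 ^ 3 * x 1 + H 0 0 0 2 * x 0 ^ 3 * x 2 + H 0 1 1 1 * x 0 * x 1 ^ 3 +
        H 1 1 1 2 * x 1 ^ 3 * x 2 + H 0 2 2 2 * x 0 * x 2 ^ 3 + H 1 2 2 2 * x 1 * x 2 ^ 3) +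
      6 * (H 0 0 1 1 * x 0 ^ 2 * x 1 ^ 2 + H 0 0 2 2 * x 0 ^ 2 * x 2 ^ 2 +
        H 1 1 2 2 * x 1 ^ 2 * x 2 ^ 2) +
      12 * (H 0 0 1 2 * x 0 ^ 2 * x 1 * x 2 + H 0 1 1 2 * x 0 * x 1 ^ 2 * x 2 +
        H 0 1 2 2 * x 0 * x 1 * x 2 ^ 2) := by
  simp only [form, Fin.sum_univ_three, hH.sort_eq]
  ring

lemma IsSymm.rot {H : Tensor4} (hH : H.IsSymm) (g : Matrix (Fin 3) (Fin 3) ℝ) :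
    (rot g H).IsSymm := by
  constructor <;> intro i j k l <;> unfold Tensor4.rot
  · rw [Finset.sum_comm]
    refine Finset.sum_congr rfl fun a _ => Finset.sum_congr rfl fun b _ =>
      Finset.sum_congr rfl fun c _ => Finset.sum_congr rfl fun d _ => ?_
    rw [hH.swap₁]; ring
  · refine Finset.sum_congr rfl fun a _ => ?_
    rw [Finset.sum_comm]
    refine Finset.sum_congr rfl fun b _ =>
      Finset.sum_congr rfl fun c _ => Finset.sum_congr rfl fun d _ => ?_
    rw [hH.swap₂]; ring
  · refine Finset.sum_congr rfl fun a _ => Finset.sum_congr rfl fun b _ => ?_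
    rw [Finset.sum_comm]
    refine Finset.sum_congr rfl fun c _ => Finset.sum_congr rfl fun d _ => ?_
    rw [hH.swap₃]; ring

lemma transpose_mul_self_apply {g : Matrix (Fin 3) (Fin 3) ℝ} (hg : gᵀ * g = 1) (a b : Fin 3) :
    ∑ i, g i a * g i b = if a = b then 1 else 0 := by
  simpa [Matrix.mul_apply, Matrix.one_apply] using congrFun (congrFun hg a) b

lemma IsTraceless.rot {H : Tensor4} (hH : H.IsTraceless) {g : Matrix (Fin 3) (Fin 3) ℝ}
    (hg : gᵀ * g = 1) : (rot g H).IsTraceless := by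
  intro k l
  have key : ∀ F : Fin 3 → Fin 3 → ℝ,
      ∑ i, ∑ a, ∑ b, g i a * g i b * F a b = ∑ a, F a a := fun F => by
    rw [Finset.sum_comm]
    refine Finset.sum_congr rfl fun a _ => ?_
    rw [Finset.sum_comm]
    simp only [← Finset.sum_mul, transpose_mul_self_apply hg, ite_mul, one_mul, zero_mul,
      Finset.sum_ite_eq, Finset.mem_univ, if_true]
  calc ∑ i, Tensor4.rot g H i i k l
      = ∑ i, ∑ a, ∑ b, g i a * g i b * ∑ c, ∑ d, g k c * g l d * H a b c d := by
        simp only [Tensor4.rot, Finset.mul_sum, mul_assoc]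
    _ = ∑ a, ∑ c, ∑ d, g k c * g l d * H a a c d := key _
    _ = ∑ c, ∑ d, g k c * g l d * ∑ a, H a a c d := by
        rw [Finset.sum_comm]
        refine Finset.sum_congr rfl fun c _ => ?_
        rw [Finset.sum_comm]
        simp only [Finset.mul_sum]
    _ = 0 := by simp [hH _ _]

lemma gram_rot {g : Matrix (Fin 3) (Fin 3) ℝ} (hg : gᵀ * g = 1) (H : Tensor4) :
    gram (rot g H) = g * gram H * gᵀ := by
  let M (K : Tensor4) : Matrix (Fin 3 × Fin 3 × Fin 3) (Fin 3) ℝ :=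
    Matrix.of fun t i => K t.1 t.2.1 t.2.2 i
  have hgram : ∀ K, gram K = (M K)ᵀ * M K := fun K => by
    ext i j
    simp [M, gram, Matrix.mul_apply, Fintype.sum_prod_type]
  have hrot : M (rot g H) = Matrix.kronecker g (Matrix.kronecker g g) * M H * gᵀ := by
    ext ⟨i, j, k⟩ l
    simp only [M, rot, Matrix.mul_apply, Matrix.of_apply, Fintype.sum_prod_type,
      Matrix.kronecker, Matrix.kroneckerMap_apply, Matrix.transpose_apply, Finset.sum_mul]
    symm
    rw [Finset.sum_comm]
    refine Finset.sum_congr rfl fun a _ => ?_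
    rw [Finset.sum_comm]
    refine Finset.sum_congr rfl fun b _ => ?_
    rw [Finset.sum_comm]
    refine Finset.sum_congr rfl fun c _ => Finset.sum_congr rfl fun d _ => ?_
    ring
  have hk : (Matrix.kronecker g (Matrix.kronecker g g))ᵀ *
      Matrix.kronecker g (Matrix.kronecker g g) = 1 := by
    simp only [Matrix.kronecker, ← Matrix.kroneckerMap_transpose, ← Matrix.mul_kronecker_mul, hg,
      Matrix.one_kronecker_one]
  rw [hgram, hgram, hrot]
  simp only [Matrix.transpose_mul, Matrix.transpose_transpose, Matrix.mul_assoc]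
  rw [← Matrix.mul_assoc _ _ (M H * gᵀ), hk, Matrix.one_mul]

/-- A symmetric tensor is determined by its quartic form. -/
lemma IsSymm.ext_form {H K : Tensor4} (hH : H.IsSymm) (hK : K.IsSymm)
    (h : ∀ x, form H x = form K x) : H = K := by
  simp only [hH.form_eq, hK.form_eq] at h
  have h' := fun x y z : ℝ => h ![x, y, z]
  simp only [Matrix.cons_val] at h'
  clear h
  have h400 := h' 1 0 0
  have h040 := h' 0 1 0
  have h004 := h' 0 0 1
  have h310 := h' 1 1 0
  have h311 := h' 1 (-1) 0
  have h312 := h' 1 2 0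
  have h301 := h' 1 0 1
  have h302 := h' 1 0 (-1)
  have h303 := h' 1 0 2
  have h031 := h' 0 1 1
  have h032 := h' 0 1 (-1)
  have h033 := h' 0 1 2
  have h211 := h' 1 1 1
  have h121 := h' 1 (-1) 1
  have h112 := h' 1 1 (-1)
  norm_num at h400 h040 h004 h310 h311 h312 h301 h302 h303 h031 h032 h033 h211 h121 h112
  have e0011 : H 0 0 1 1 = K 0 0 1 1 := by linarith only [h400, h040, h310, h311]
  have e0022 : H 0 0 2 2 = K 0 0 2 2 := by linarith only [h400, h004, h301, h302]
  have e1122 : H 1 1 2 2 = K 1 1 2 2 := by linarith only [h040, h004, h031, h032]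
  have e0001 : H 0 0 0 1 = K 0 0 0 1 := by linarith only [h400, h040, h310, h312, e0011]
  have e0111 : H 0 1 1 1 = K 0 1 1 1 := by linarith only [h400, h040, h310, h312, e0011]
  have e0002 : H 0 0 0 2 = K 0 0 0 2 := by linarith only [h400, h004, h301, h303, e0022]
  have e0222 : H 0 2 2 2 = K 0 2 2 2 := by linarith only [h400, h004, h301, h303, e0022]
  have e1112 : H 1 1 1 2 = K 1 1 1 2 := by linarith only [h040, h004, h031, h033, e1122]
  have e1222 : H 1 2 2 2 = K 1 2 2 2 := by linarith only [h040, h004, h031, h033, e1122]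
  simp only [h400, h040, h004, e0011, e0022, e1122, e0001, e0111, e0002, e0222, e1112, e1222]
    at h211 h121 h112
  have e0012 : H 0 0 1 2 = K 0 0 1 2 := by linarith only [h211, h121, h112]
  have e0112 : H 0 1 1 2 = K 0 1 1 2 := by linarith only [h211, h121, h112]
  have e0122 : H 0 1 2 2 = K 0 1 2 2 := by linarith only [h211, h121, h112]
  funext i j k l
  fin_cases i <;> fin_cases j <;> fin_cases k <;> fin_cases l <;>
    simp only [Fin.zero_eta, Fin.mk_one, Fin.reduceFinMk, hH.sort_eq, hK.sort_eq, *]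

end Tensor4

namespace Tensor4

lemma four_mul_sq_le {A D : ℝ} (h₁ : (-13 * A + 4 * D) ^ 2 ≤ 1024 * A ^ 2)
    (h₂ : (-13 * A - 4 * D) ^ 2 ≤ 1024 * A ^ 2) : 16 * D ^ 2 ≤ 361 * A ^ 2 := by
  have e : 1024 * A ^ 2 = (32 * A) ^ 2 := by ring
  rw [e, sq_le_sq] at h₁ h₂
  have : |4 * D| ≤ |19 * A| := by
    rcases abs_cases A with hA | hA <;> rcases abs_cases D with hD | hD <;>
      simp only [abs_mul, abs_le, hA.1, hD.1, Nat.abs_ofNat] at h₁ h₂ ⊢ <;> grind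
  have := sq_le_sq.mpr this
  linarith

/-- The components of an isotropic `gram` whose form is dominated by its value at the third
basis vector. -/
lemma eq_zero_of_gram_of_le {A B C D E F G : ℝ} (hA : A ≠ 0)
    (h02 : D * (5 * B + 4 * F) + E * (5 * C + 4 * G) = 0)
    (h12 : D * (4 * G - 5 * C) + E * (5 * B - 4 * F) = 0)
    (h01 : B * G = C * (F - 15 * A))
    (h00 : 15 * A * B + B * F + G * C = 0)
    (h22 : 50 * A ^ 2 + (B ^ 2 + C ^ 2) = (D ^ 2 + E ^ 2) + 2 * (F ^ 2 + G ^ 2))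
    (b₁ : (3 * A - B + F) ^ 2 ≤ 64 * A ^ 2) (b₂ : (3 * A + B + F) ^ 2 ≤ 64 * A ^ 2)
    (b₃ : (12 * A - 4 * C - 4 * F) ^ 2 ≤ 1024 * A ^ 2)
    (b₄ : (12 * A + 4 * C - 4 * F) ^ 2 ≤ 1024 * A ^ 2)
    (b₅ : (-13 * A + 5 * B + F + 4 * D) ^ 2 ≤ 1024 * A ^ 2)
    (b₆ : (-13 * A + 5 * B + F - 4 * D) ^ 2 ≤ 1024 * A ^ 2)
    (b₇ : (-13 * A - 5 * B + F + 4 * E) ^ 2 ≤ 1024 * A ^ 2)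
    (b₈ : (-13 * A - 5 * B + F - 4 * E) ^ 2 ≤ 1024 * A ^ 2) :
    B = 0 ∧ C = 0 ∧ D = 0 ∧ E = 0 ∧ F ^ 2 + G ^ 2 = 25 * A ^ 2 := by
  have hA2 : 0 < A ^ 2 := by positivity
  have hBC : B ^ 2 + C ^ 2 = 0 := by
    by_contra hne
    have key : (B ^ 2 + C ^ 2) * (F ^ 2 + G ^ 2 - 225 * A ^ 2) = 0 := by
      linear_combination (B * F + G * C - 15 * A * B) * h00 +
        (B * G - C * F - 15 * A * C) * h01
    have := (mul_eq_zero.mp key).resolve_left hne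
    linarith [sq_nonneg D, sq_nonneg E, sq_nonneg F]
  have hB : B = 0 := pow_eq_zero_iff two_ne_zero |>.mp (by linarith [sq_nonneg B, sq_nonneg C])
  have hC : C = 0 := pow_eq_zero_iff two_ne_zero |>.mp (by linarith [sq_nonneg B, sq_nonneg C])
  subst hB hC
  have key : (D ^ 2 + E ^ 2) * (F ^ 2 + G ^ 2) = 0 := by
    linear_combination (D * F + E * G) / 4 * h02 + (D * G - E * F) / 4 * h12
  rcases mul_eq_zero.mp key with h | h
  · have hD : D = 0 := pow_eq_zero_iff two_ne_zero |>.mp (by linarith [sq_nonneg D, sq_nonneg E])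
    have hE : E = 0 := pow_eq_zero_iff two_ne_zero |>.mp (by linarith [sq_nonneg D, sq_nonneg E])
    subst hD hE
    exact ⟨rfl, rfl, rfl, rfl, by linarith⟩
  · have hF : F = 0 := pow_eq_zero_iff two_ne_zero |>.mp (by linarith [sq_nonneg F, sq_nonneg G])
    subst hF
    have hD := four_mul_sq_le (A := A) (D := D) (by linarith) (by linarith)
    have hE := four_mul_sq_le (A := A) (D := E) (by linarith) (by linarith)
    linarith

/-- The form of a harmonic tensor for which the third basis vector is critical. -/
lemma form_eq_of_critical {K : Tensor4} (hK : K.IsSymm) (hK0 : K.IsTraceless)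
    (h02 : K 0 2 2 2 = 0) (h12 : K 1 2 2 2 = 0) :
    ∃ A B C D E F G : ℝ, K 2 2 2 2 = 8 * A ∧ K 0 0 2 2 = B - 4 * A ∧ K 1 1 2 2 = -B - 4 * A ∧
      K 0 1 2 2 = C ∧ K 0 0 0 0 = 3 * A - B + F ∧ K 1 1 1 1 = 3 * A + B + F ∧
      K 0 0 1 1 = A - F ∧ K 0 0 0 1 = G - C / 2 ∧ K 0 1 1 1 = -C / 2 - G ∧
      K 0 0 0 2 = D ∧ K 0 1 1 2 = -D ∧ K 0 0 1 2 = E ∧ K 1 1 1 2 = -E := by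
  have h := hK0
  simp only [IsTraceless, Fin.sum_univ_three] at h
  have t00 := h 0 0
  have t01 := h 0 1
  have t02 := h 0 2
  have t11 := h 1 1
  have t12 := h 1 2
  have t22 := h 2 2
  simp only [hK.sort_eq, h02, h12] at t00 t01 t02 t11 t12 t22
  exact ⟨K 2 2 2 2 / 8, K 0 0 2 2 + K 2 2 2 2 / 2, K 0 1 2 2, K 0 0 0 2, K 0 0 1 2,
    K 2 2 2 2 / 8 - K 0 0 1 1, K 0 0 0 1 + K 0 1 2 2 / 2, by constructorm* _ ∧ _ <;> linarith⟩

lemma exists_form_eq {K : Tensor4} (hK : K.IsSymm) (hK0 : K.IsTraceless)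
    (h02 : K 0 2 2 2 = 0) (h12 : K 1 2 2 2 = 0) (h2 : K 2 2 2 2 ≠ 0) {c : ℝ}
    (hc : gram K = c • (1 : Matrix (Fin 3) (Fin 3) ℝ))
    (hmax : ∀ x, form K x ^ 2 ≤ K 2 2 2 2 ^ 2 * (x 0 ^ 2 + x 1 ^ 2 + x 2 ^ 2) ^ 4) :
    ∃ A F G : ℝ, A ≠ 0 ∧ F ^ 2 + G ^ 2 = 25 * A ^ 2 ∧ ∀ x, form K x =
      A * (8 * x 2 ^ 4 - 24 * x 2 ^ 2 * (x 0 ^ 2 + x 1 ^ 2) + 3 * (x 0 ^ 2 + x 1 ^ 2) ^ 2) +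
      F * (x 0 ^ 4 - 6 * x 0 ^ 2 * x 1 ^ 2 + x 1 ^ 4) + 4 * G * (x 0 ^ 3 * x 1 - x 0 * x 1 ^ 3) := by
  obtain ⟨A, B, C, D, E, F, G, e2222, e0022, e1122, e0122, e0000, e1111, e0011, e0001, e0111,
    e0002, e0112, e0012, e1112⟩ := form_eq_of_critical hK hK0 h02 h12
  have hA : A ≠ 0 := by rintro rfl; simp [e2222] at h2
  have hg := fun i j => congrFun (congrFun hc i) j
  have g00 := hg 0 0
  have g11 := hg 1 1
  have g22 := hg 2 2
  have g01 := hg 0 1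
  have g02 := hg 0 2
  have g12 := hg 1 2
  simp [gram, Fin.sum_univ_three, hK.sort_eq] at g00 g11 g22 g01 g02 g12
  have b := fun x y z : ℝ => hmax ![x, y, z]
  simp only [hK.form_eq, Matrix.cons_val] at b
  have b₁ := b 1 0 0
  have b₂ := b 0 1 0
  have b₃ := b 1 1 0
  have b₄ := b 1 (-1) 0
  have b₅ := b 1 0 1
  have b₆ := b (-1) 0 1
  have b₇ := b 0 (-1) 1
  have b₈ := b 0 1 1
  simp only [e2222, e0022, e1122, e0122, e0000, e1111, e0011, e0001, e0111,
    e0002, e0112, e0012, e1112, h02, h12] at g00 g11 g22 g01 g02 g12 b₁ b₂ b₃ b₄ b₅ b₆ b₇ b₈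
  ring_nf at b₁ b₂ b₃ b₄ b₅ b₆ b₇ b₈
  obtain ⟨hB, hC, hD, hE, hFG⟩ := eq_zero_of_gram_of_le (A := A) (B := B) (C := C) (D := D)
    (E := E) (F := F) (G := G) hA (by linarith) (by linarith) (by linarith) (by linarith)
    (by linarith) (by linarith) (by linarith) (by linarith) (by linarith) (by linarith)
    (by linarith) (by linarith) (by linarith)
  refine ⟨A, F, G, hA, hFG, fun x => ?_⟩
  simp only [hK.form_eq, e2222, e0022, e1122, e0122, e0000, e1111, e0011, e0001, e0111,
    e0002, e0112, e0012, e1112, h02, h12, hB, hC, hD, hE]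
  ring

end Tensor4

lemma transpose_mul_of_mem_SO3 {g : Matrix (Fin 3) (Fin 3) ℝ} (hg : g ∈ SO3) : gᵀ * g = 1 :=
  mul_eq_one_comm.mp hg.1

lemma inv_eq_transpose_of_mem_SO3 {g : Matrix (Fin 3) (Fin 3) ℝ} (hg : g ∈ SO3) : g⁻¹ = gᵀ :=
  Matrix.inv_eq_right_inv hg.1

lemma transpose_mem_SO3 {g : Matrix (Fin 3) (Fin 3) ℝ} (hg : g ∈ SO3) : gᵀ ∈ SO3 :=
  ⟨by rw [Matrix.transpose_transpose, transpose_mul_of_mem_SO3 hg], by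
    rw [Matrix.det_transpose, hg.2]⟩

lemma mul_mem_SO3 {g h : Matrix (Fin 3) (Fin 3) ℝ} (hg : g ∈ SO3) (hh : h ∈ SO3) :
    g * h ∈ SO3 :=
  ⟨by rw [Matrix.transpose_mul, Matrix.mul_assoc, ← Matrix.mul_assoc h, hh.1, Matrix.one_mul,
    hg.1], by rw [Matrix.det_mul, hg.2, hh.2, one_mul]⟩

lemma sq_sum_mulVec_of_mem_SO3 {g : Matrix (Fin 3) (Fin 3) ℝ} (hg : g ∈ SO3) (x : Fin 3 → ℝ) :
    (g *ᵥ x) 0 ^ 2 + (g *ᵥ x) 1 ^ 2 + (g *ᵥ x) 2 ^ 2 = x 0 ^ 2 + x 1 ^ 2 + x 2 ^ 2 := by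
  have h : (g *ᵥ x) ⬝ᵥ (g *ᵥ x) = x ⬝ᵥ x := by
    rw [Matrix.dotProduct_mulVec, Matrix.vecMul_mulVec, ← Matrix.dotProduct_mulVec,
      transpose_mul_of_mem_SO3 hg, Matrix.one_mulVec]
  simpa only [dotProduct, Fin.sum_univ_three, ← sq] using h

/-- Every unit vector is the last vector of a positively oriented orthonormal basis. -/
lemma exists_mem_SO3_row {u : Fin 3 → ℝ} (hu : u 0 ^ 2 + u 1 ^ 2 + u 2 ^ 2 = 1) :
    ∃ g ∈ SO3, g 2 = u := by
  obtain ⟨v, hv, huv⟩ : ∃ v : Fin 3 → ℝ, v 0 ^ 2 + v 1 ^ 2 + v 2 ^ 2 = 1 ∧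
      u 0 * v 0 + u 1 * v 1 + u 2 * v 2 = 0 := by
    by_cases h : u 0 ^ 2 + u 1 ^ 2 = 0
    · refine ⟨![1, 0, 0], by simp, ?_⟩
      have : u 0 = 0 := pow_eq_zero_iff two_ne_zero |>.mp
        (by linarith [sq_nonneg (u 0), sq_nonneg (u 1)])
      simp [this]
    · have hs : √(u 0 ^ 2 + u 1 ^ 2) ^ 2 = u 0 ^ 2 + u 1 ^ 2 := Real.sq_sqrt (by positivity)
      refine ⟨![-u 1 / √(u 0 ^ 2 + u 1 ^ 2), u 0 / √(u 0 ^ 2 + u 1 ^ 2), 0], ?_, ?_⟩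
      · simp only [Matrix.cons_val, div_pow, hs]
        field_simp
        ring
      · simp only [Matrix.cons_val]
        ring
  refine ⟨!![v 0, v 1, v 2;
    u 1 * v 2 - u 2 * v 1, u 2 * v 0 - u 0 * v 2, u 0 * v 1 - u 1 * v 0; u 0, u 1, u 2],
    ⟨?_, ?_⟩, ?_⟩
  · ext i j
    fin_cases i <;> fin_cases j <;>
      simp [Matrix.mul_apply, Fin.sum_univ_three] <;> grind
  · simp [Matrix.det_fin_three]
    grind
  · ext j
    fin_cases j <;> rfl

/-- Rotating about the third axis brings a quartic angular term to a pure cosine. -/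
lemma exists_angle {A F G : ℝ} (hA : A ≠ 0) (h : F ^ 2 + G ^ 2 = 25 * A ^ 2) :
    ∃ c s : ℝ, c ^ 2 + s ^ 2 = 1 ∧ F = 5 * A * (c ^ 4 - 6 * c ^ 2 * s ^ 2 + s ^ 4) ∧
      G = 5 * A * (4 * (c ^ 3 * s - c * s ^ 3)) := by
  obtain ⟨w, hw⟩ := IsAlgClosed.exists_pow_nat_eq (⟨F / (5 * A), G / (5 * A)⟩ : ℂ)
    (n := 4) (by norm_num)
  have hnorm : (w.re ^ 2 + w.im ^ 2) ^ 4 = 1 := by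
    have := congrArg Complex.normSq hw
    rw [map_pow, Complex.normSq_apply, Complex.normSq_mk] at this
    rw [sq, sq, this]
    field_simp
    linarith
  have hre := congrArg Complex.re hw
  have him := congrArg Complex.im hw
  simp only [pow_succ, pow_zero, one_mul, Complex.mul_re, Complex.mul_im] at hre him
  refine ⟨w.re, w.im, (pow_eq_one_iff_of_nonneg (by positivity) (by norm_num)).mp hnorm, ?_, ?_⟩
  · field_simp at hre
    linarith
  · field_simp at him
    linarith

lemma coeff_eq_zero_of_sq_le {m n p q r : ℝ} (hm : m ≠ 0)
    (h : ∀ t : ℝ, (r * t ^ 4 + 4 * q * t ^ 3 + 6 * p * t ^ 2 + 4 * n * t + m) ^ 2 ≤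
      m ^ 2 * (t ^ 2 + 1) ^ 4) : n = 0 := by
  let f : Polynomial ℝ :=
    (.C r * .X ^ 4 + .C (4 * q) * .X ^ 3 + .C (6 * p) * .X ^ 2 + .C (4 * n) * .X + .C m) ^ 2 -
      .C (m ^ 2) * (.X ^ 2 + 1) ^ 4
  have hmax : IsLocalMax (fun t => f.eval t) 0 := by
    refine Filter.Eventually.of_forall fun t => ?_
    have := h t
    simp [f] at this ⊢
    linarith
  have h0 := hmax.hasDerivAt_eq_zero (f.hasDerivAt 0)
  simp [f, Polynomial.derivative_pow] at h0
  grind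

namespace Tensor4

lemma form_smul (H : Tensor4) (s : ℝ) (x : Fin 3 → ℝ) : form H (s • x) = s ^ 4 * form H x := by
  simp only [form, Finset.mul_sum, Pi.smul_apply, smul_eq_mul]
  refine Finset.sum_congr rfl fun a _ => Finset.sum_congr rfl fun b _ =>
    Finset.sum_congr rfl fun c _ => Finset.sum_congr rfl fun d _ => ?_
  ring

lemma continuous_form (H : Tensor4) : Continuous (form H) := by
  unfold form
  fun_prop

lemma exists_forall_form_sq_le (H : Tensor4) : ∃ u : Fin 3 → ℝ,
    u 0 ^ 2 + u 1 ^ 2 + u 2 ^ 2 = 1 ∧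
      ∀ x, form H x ^ 2 ≤ form H u ^ 2 * (x 0 ^ 2 + x 1 ^ 2 + x 2 ^ 2) ^ 4 := by
  let S : Set (Fin 3 → ℝ) := {x | x 0 ^ 2 + x 1 ^ 2 + x 2 ^ 2 = 1}
  have hS : IsCompact S := by
    refine Metric.isCompact_of_isClosed_isBounded
      (isClosed_eq (by fun_prop) continuous_const) ?_
    refine (Metric.isBounded_closedBall (x := (0 : Fin 3 → ℝ)) (r := 1)).subset fun x hx => ?_
    rw [mem_closedBall_zero_iff, pi_norm_le_iff_of_nonneg zero_le_one]
    intro i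
    have hx' : x 0 ^ 2 + x 1 ^ 2 + x 2 ^ 2 = 1 := hx
    rw [Real.norm_eq_abs, ← sq_le_one_iff_abs_le_one]
    fin_cases i <;> simp only [Fin.zero_eta, Fin.mk_one, Fin.reduceFinMk] <;>
      linarith [sq_nonneg (x 0), sq_nonneg (x 1), sq_nonneg (x 2)]
  obtain ⟨u, hu, hmax⟩ := hS.exists_isMaxOn ⟨![1, 0, 0], by simp [S]⟩
    ((continuous_form H).pow 2).continuousOn
  refine ⟨u, hu, fun x => ?_⟩
  set n := x 0 ^ 2 + x 1 ^ 2 + x 2 ^ 2 with hn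
  by_cases h0 : n = 0
  · have hx : x = (0 : ℝ) • x := by
      ext i
      fin_cases i <;> simp <;> apply (pow_eq_zero_iff two_ne_zero).mp <;>
        linarith [sq_nonneg (x 0), sq_nonneg (x 1), sq_nonneg (x 2)]
    rw [hx, form_smul]
    simp
    positivity
  · have hpos : 0 < n := lt_of_le_of_ne (by positivity) (Ne.symm h0)
    have hs : √n ^ 2 = n := Real.sq_sqrt hpos.le
    have hs0 : √n ≠ 0 := (Real.sqrt_pos.mpr hpos).ne'
    have hmem : (√n)⁻¹ • x ∈ S := by
      simp only [S, Set.mem_ofPred_eq, Pi.smul_apply, smul_eq_mul, mul_pow, inv_pow, hs]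
      field_simp
      exact hn.symm
    have hx : x = √n • ((√n)⁻¹ • x) := by rw [smul_smul, mul_inv_cancel₀ hs0, one_smul]
    have hs4 : (√n ^ 4) ^ 2 = n ^ 4 := by
      rw [show (√n ^ 4) ^ 2 = (√n ^ 2) ^ 4 by ring, hs]
    calc form H x ^ 2 = n ^ 4 * form H ((√n)⁻¹ • x) ^ 2 := by
          conv_lhs => rw [hx]
          rw [form_smul, mul_pow, hs4]
      _ ≤ n ^ 4 * form H u ^ 2 := mul_le_mul_of_nonneg_left (hmax hmem) (by positivity)
      _ = _ := mul_comm _ _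

/-- A harmonic tensor with non-zero isotropic `gram` is cubic: its form is a multiple of the
harmonic part of `x₀⁴ + x₁⁴ + x₂⁴` in some orthonormal frame. -/
theorem exists_cubic_form {H : Tensor4} (hH : H.IsSymm) (hH0 : H.IsTraceless) {c : ℝ}
    (hc : gram H = c • (1 : Matrix (Fin 3) (Fin 3) ℝ)) (hne : H ≠ 0) :
    ∃ h ∈ SO3, ∃ A : ℝ, A ≠ 0 ∧ ∀ x, form H (h *ᵥ x) =
      A * (20 * (x 0 ^ 4 + x 1 ^ 4 + x 2 ^ 4) - 12 * (x 0 ^ 2 + x 1 ^ 2 + x 2 ^ 2) ^ 2) := by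
  obtain ⟨u, hu, hmax⟩ := exists_forall_form_sq_le H
  have hu0 : form H u ≠ 0 := fun h0 => hne <| hH.ext_form (K := 0) ⟨by simp, by simp, by simp⟩
    fun x => by
      have := hmax x
      rw [h0] at this
      have h1 : form H x = 0 := by
        apply (pow_eq_zero_iff two_ne_zero).mp
        exact le_antisymm (by linarith) (sq_nonneg _)
      rw [h1]
      simp [form]
  obtain ⟨g, hg, hgu⟩ := exists_mem_SO3_row hu
  have hgg := transpose_mul_of_mem_SO3 hg
  have hK := hH.rot g
  have hform := form_rot g H
  have hgram := gram_rot hgg H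
  rw [hc, Matrix.mul_smul, Matrix.mul_one, Matrix.smul_mul, hg.1] at hgram
  have hK0 := hH0.rot hgg
  set K := rot g H
  have hKu : K 2 2 2 2 = form H u := by
    have h := hform ![0, 0, 1]
    rw [hK.form_eq] at h
    have : gᵀ *ᵥ ![0, 0, 1] = u := by
      rw [← hgu]
      ext i
      simp [Matrix.mulVec, dotProduct, Fin.sum_univ_three]
    rw [this] at h
    simpa only [Matrix.cons_val, zero_pow, ne_eq, OfNat.ofNat_ne_zero, not_false_eq_true,
      mul_zero, zero_mul, add_zero, zero_add, one_pow, mul_one, three_ne_zero] using h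
  have hKmax : ∀ x, form K x ^ 2 ≤ K 2 2 2 2 ^ 2 * (x 0 ^ 2 + x 1 ^ 2 + x 2 ^ 2) ^ 4 := fun x => by
    rw [hform, hKu, ← sq_sum_mulVec_of_mem_SO3 (transpose_mem_SO3 hg) x]
    exact hmax _
  have b := fun x y z : ℝ => hKmax ![x, y, z]
  simp only [hK.form_eq, Matrix.cons_val] at b
  have h02 : K 0 2 2 2 = 0 := coeff_eq_zero_of_sq_le (m := K 2 2 2 2) (hKu ▸ hu0)
    (p := K 0 0 2 2) (q := K 0 0 0 2) (r := K 0 0 0 0) fun t => by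
      have := b t 0 1
      ring_nf at this ⊢
      exact this
  have h12 : K 1 2 2 2 = 0 := coeff_eq_zero_of_sq_le (m := K 2 2 2 2) (hKu ▸ hu0)
    (p := K 1 1 2 2) (q := K 1 1 1 2) (r := K 1 1 1 1) fun t => by
      have := b 0 t 1
      ring_nf at this ⊢
      exact this
  obtain ⟨A, F, G, hA, hFG, hKform⟩ := exists_form_eq hK hK0 h02 h12 (hKu ▸ hu0) hgram hKmax
  obtain ⟨p, s, hps, hF, hG⟩ := exists_angle hA hFG
  have hR : !![p, -s, 0; s, p, 0; 0, 0, 1] ∈ SO3 := by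
    constructor
    · ext i j
      fin_cases i <;> fin_cases j <;>
        simp [Matrix.mul_apply, Fin.sum_univ_three] <;> linarith
    · simp [Matrix.det_fin_three]
      linarith
  refine ⟨gᵀ * !![p, -s, 0; s, p, 0; 0, 0, 1], mul_mem_SO3 (transpose_mem_SO3 hg) hR, A, hA,
    fun x => ?_⟩
  rw [← Matrix.mulVec_mulVec, ← hform, hKform]
  have e0 : (!![p, -s, 0; s, p, 0; 0, 0, 1] *ᵥ x) 0 = p * x 0 - s * x 1 := by
    simp [Matrix.mulVec, dotProduct, Fin.sum_univ_three]; ring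
  have e1 : (!![p, -s, 0; s, p, 0; 0, 0, 1] *ᵥ x) 1 = s * x 0 + p * x 1 := by
    simp [Matrix.mulVec, dotProduct, Fin.sum_univ_three]
  have e2 : (!![p, -s, 0; s, p, 0; 0, 0, 1] *ᵥ x) 2 = x 2 := by
    simp [Matrix.mulVec, dotProduct, Fin.sum_univ_three]
  rw [e0, e1, e2, hF, hG]
  have hr : (p * x 0 - s * x 1) ^ 2 + (s * x 0 + p * x 1) ^ 2 = x 0 ^ 2 + x 1 ^ 2 := by
    linear_combination (x 0 ^ 2 + x 1 ^ 2) * hps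
  have hq : (p ^ 2 + s ^ 2) ^ 4 = 1 := by rw [hps, one_pow]
  rw [hr]
  linear_combination 5 * A * (x 0 ^ 4 - 6 * x 0 ^ 2 * x 1 ^ 2 + x 1 ^ 4) * hq

end Tensor4

namespace Tensor4

lemma eq_zero_of_gram_eq_zero {H : Tensor4} (h : gram H = 0) : H = 0 := by
  funext k l m i
  have hi : ∑ k, ∑ l, ∑ m, H k l m i * H k l m i = 0 := congrFun (congrFun h i) i
  have h₁ := (Finset.sum_eq_zero_iff_of_nonneg fun k _ => Finset.sum_nonneg fun l _ =>
    Finset.sum_nonneg fun m _ => mul_self_nonneg (H k l m i)).mp hi k (Finset.mem_univ _)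
  have h₂ := (Finset.sum_eq_zero_iff_of_nonneg fun l _ =>
    Finset.sum_nonneg fun m _ => mul_self_nonneg (H k l m i)).mp h₁ l (Finset.mem_univ _)
  have h₃ := (Finset.sum_eq_zero_iff_of_nonneg fun m _ =>
    mul_self_nonneg (H k l m i)).mp h₂ m (Finset.mem_univ _)
  exact mul_self_eq_zero.mp h₃

end Tensor4

lemma pderiv_pderiv_comm {σ R : Type*} [CommRing R] (i j : σ) (p : MvPolynomial σ R) :
    pderiv i (pderiv j p) = pderiv j (pderiv i p) := by
  classical
  have h : ⁅(pderiv i : Derivation R (MvPolynomial σ R) (MvPolynomial σ R)), pderiv j⁆ = 0 :=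
    derivation_ext fun k => by
      rw [Derivation.commutator_apply]
      simp [pderiv_X, Pi.single_apply, apply_ite]
  have := congrArg (fun D => D p) h
  simpa [Derivation.commutator_apply, sub_eq_zero] using this

/-- The tensor of fourth derivatives of a polynomial at the origin. -/
noncomputable def fourthDeriv (p : MvPolynomial (Fin 3) ℝ) : Tensor4 := fun i j k l =>
  eval 0 (pderiv i (pderiv j (pderiv k (pderiv l p))))

lemma isSymm_fourthDeriv (p : MvPolynomial (Fin 3) ℝ) : (fourthDeriv p).IsSymm := by
  constructor <;> intro i j k l <;> unfold fourthDeriv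
  · rw [pderiv_pderiv_comm]
  · rw [pderiv_pderiv_comm j k]
  · rw [pderiv_pderiv_comm k l]

lemma isTraceless_fourthDeriv {p : MvPolynomial (Fin 3) ℝ} (h : lap p = 0) :
    (fourthDeriv p).IsTraceless := fun k l => by
  have := congrArg (fun q => eval 0 (pderiv k (pderiv l q))) h
  simp only [lap, map_sum, map_zero] at this
  rw [← this]
  refine Finset.sum_congr rfl fun i _ => ?_
  rw [fourthDeriv, pderiv_pderiv_comm l i, pderiv_pderiv_comm k i, pderiv_pderiv_comm l i,
    pderiv_pderiv_comm k i]

lemma gram_fourthDeriv (p : MvPolynomial (Fin 3) ℝ) : Tensor4.gram (fourthDeriv p) = d2 p := rfl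

lemma natCast_mul_eval_eq_sum {p : MvPolynomial (Fin 3) ℝ} {n : ℕ} (h : p.IsHomogeneous n)
    (x : Fin 3 → ℝ) : n * eval x p = ∑ i, x i * eval x (pderiv i p) := by
  simpa using (congrArg (eval x) h.sum_X_mul_pderiv).symm

/-- Euler's identity, iterated: a quartic form is determined by its fourth derivatives. -/
lemma form_fourthDeriv {p : MvPolynomial (Fin 3) ℝ} (hp : p.IsHomogeneous 4) (x : Fin 3 → ℝ) :
    (fourthDeriv p).form x = 24 * eval x p := by
  have hconst (i j k l) : eval x (pderiv l (pderiv k (pderiv j (pderiv i p)))) =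
      fourthDeriv p i j k l := by
    have h0 := hp.pderiv (i := i).pderiv (i := j).pderiv (i := k).pderiv (i := l)
    rw [← totalDegree_zero_iff_isHomogeneous, totalDegree_eq_zero_iff_eq_C] at h0
    have hs := isSymm_fourthDeriv p
    rw [show fourthDeriv p i j k l = fourthDeriv p l k j i by
      rw [hs.swap₁, hs.swap₂, hs.swap₁, hs.swap₃, hs.swap₂, hs.swap₁], fourthDeriv, h0,
      eval_C, eval_C]
  have h₁ := natCast_mul_eval_eq_sum hp x
  have h₂ i := natCast_mul_eval_eq_sum (hp.pderiv (i := i)) x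
  have h₃ i j := natCast_mul_eval_eq_sum (hp.pderiv (i := i).pderiv (i := j)) x
  have h₄ i j k := natCast_mul_eval_eq_sum (hp.pderiv (i := i).pderiv (i := j).pderiv (i := k)) x
  simp only [hconst] at h₄
  norm_num at h₁ h₂ h₃ h₄
  have e : 24 * eval x p = ∑ i, x i * ∑ j, x j * ∑ k, x k * ∑ l, x l * fourthDeriv p i j k l := by
    simp only [← h₄, ← h₃]
    simp only [mul_left_comm (x _) 2, ← Finset.mul_sum, ← h₂]
    simp only [mul_left_comm (x _) 3, ← Finset.mul_sum, ← h₁]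
    ring
  rw [e, Tensor4.form]
  simp only [Finset.mul_sum]
  refine Finset.sum_congr rfl fun i _ => Finset.sum_congr rfl fun j _ =>
    Finset.sum_congr rfl fun k _ => Finset.sum_congr rfl fun l _ => ?_
  ring

lemma fixesPoly_iff_form {p : MvPolynomial (Fin 3) ℝ} (hp : p.IsHomogeneous 4)
    {g : Matrix (Fin 3) (Fin 3) ℝ} (hg : g ∈ SO3) :
    fixesPoly g p ↔ ∀ x, (fourthDeriv p).form (gᵀ *ᵥ x) = (fourthDeriv p).form x := by
  simp only [fixesPoly, form_fourthDeriv hp, inv_eq_transpose_of_mem_SO3 hg]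
  exact forall_congr' fun x => (mul_right_inj' (by norm_num)).symm

/-- The octahedral group is the stabilizer of `x₀⁴ + x₁⁴ + x₂⁴` in `SO(3)`. -/
lemma mem_Octa_iff {g : Matrix (Fin 3) (Fin 3) ℝ} (hg : g ∈ SO3) :
    g ∈ Octa ↔ ∀ x, ∑ i, (gᵀ *ᵥ x) i ^ 4 = ∑ i, x i ^ 4 := by
  have hsq (x) : ∑ i, (gᵀ *ᵥ x) i ^ 2 = ∑ i, x i ^ 2 := by
    simpa only [Fin.sum_univ_three] using sq_sum_mulVec_of_mem_SO3 (transpose_mem_SO3 hg) x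
  constructor
  · rintro ⟨-, h⟩ x
    choose j hj using h
    have hentry (x : Fin 3 → ℝ) (i) : (gᵀ *ᵥ x) i ^ 2 = x (j i) ^ 2 := by
      have : (gᵀ *ᵥ x) i = (g *ᵥ Pi.single i 1) ⬝ᵥ x := by
        rw [Matrix.mulVec_single_one]
        rfl
      rw [this]
      rcases hj i with h | h <;> simp [h]
    have hsurj : Function.Surjective j := fun k => by
      by_contra! hk
      have := hsq (Pi.single k 1)
      simp only [hentry, Pi.single_eq_of_ne (hk _)] at this
      simp [Pi.single_apply] at this
    have hbij := hsurj.bijective_of_finite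
    calc ∑ i, (gᵀ *ᵥ x) i ^ 4 = ∑ i, x (j i) ^ 4 :=
          Finset.sum_congr rfl fun i _ => by
            rw [show 4 = 2 * 2 from rfl, pow_mul, hentry, ← pow_mul]
      _ = ∑ i, x i ^ 4 := hbij.sum_comp fun i => x i ^ 4
  · intro h
    have hrow (j i) : (gᵀ *ᵥ Pi.single j 1) i = g j i := by simp [Matrix.col]
    have hentry (j i) : g j i ^ 2 = 0 ∨ g j i ^ 2 = 1 := by
      have h₂ := hsq (Pi.single j 1)
      have h₄ := h (Pi.single j 1)
      simp only [hrow] at h₂ h₄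
      have e : ∑ i, (Pi.single j 1 : Fin 3 → ℝ) i ^ 4 = ∑ i, (Pi.single j 1 : Fin 3 → ℝ) i ^ 2 := by
        simp [Pi.single_apply]
      have h0 : ∑ i, g j i ^ 2 * (1 - g j i ^ 2) = 0 := by
        simp only [mul_sub, mul_one, Finset.sum_sub_distrib, ← pow_add]
        linarith
      have hle (i) : g j i ^ 2 ≤ 1 := by
        have : ∑ i, g j i ^ 2 = 1 := by rw [h₂]; simp [Pi.single_apply]
        rw [← this]
        exact Finset.single_le_sum (f := fun i => g j i ^ 2) (fun _ _ => sq_nonneg _)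
          (Finset.mem_univ i)
      have := (Finset.sum_eq_zero_iff_of_nonneg fun i _ =>
        mul_nonneg (sq_nonneg (g j i)) (sub_nonneg.mpr (hle i))).mp h0 i (Finset.mem_univ _)
      rcases mul_eq_zero.mp this with h | h
      · exact .inl h
      · exact .inr (by linarith)
    refine ⟨hg, fun i => ?_⟩
    have hcol := Tensor4.transpose_mul_self_apply (transpose_mul_of_mem_SO3 hg) i i
    simp only [if_true, ← sq] at hcol
    obtain ⟨j, hj⟩ : ∃ j, g j i ^ 2 ≠ 0 := by
      by_contra! h0
      simp [h0] at hcol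
    have hj1 := (hentry j i).resolve_left hj
    rw [← Finset.add_sum_erase _ _ (Finset.mem_univ j), hj1, add_eq_left,
      Finset.sum_eq_zero_iff_of_nonneg fun _ _ => sq_nonneg _] at hcol
    have hz (k) (hk : k ≠ j) : g k i = 0 := by simpa using hcol k (by simpa using hk)
    refine ⟨j, (sq_eq_sq_iff_eq_or_eq_neg.mp (hj1.trans (one_pow 2).symm)).imp (fun h1 => ?_) fun h1 => ?_⟩
    all_goals
      ext k
      by_cases hk : k = j
      · subst hk
        simpa [Matrix.col] using h1
      · simpa [Matrix.col, hk] using hz k hk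

lemma mem_image_conj_Octa_iff {g h : Matrix (Fin 3) (Fin 3) ℝ} (hh : h ∈ SO3) :
    g ∈ (fun g => h * g * h⁻¹) '' Octa ↔ hᵀ * g * h ∈ Octa := by
  rw [inv_eq_transpose_of_mem_SO3 hh]
  have h' := transpose_mul_of_mem_SO3 hh
  constructor
  · rintro ⟨k, hk, rfl⟩
    rwa [show hᵀ * (h * k * hᵀ) * h = (hᵀ * h) * k * (hᵀ * h) by simp only [Matrix.mul_assoc],
      h', Matrix.one_mul, Matrix.mul_one]
  · intro hk
    refine ⟨_, hk, ?_⟩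
    change h * (hᵀ * g * h) * hᵀ = g
    rw [show h * (hᵀ * g * h) * hᵀ = (h * hᵀ) * g * (h * hᵀ) by simp only [Matrix.mul_assoc],
      hh.1, Matrix.one_mul, Matrix.mul_one]

/-- Schur's lemma for the octahedral group. -/
lemma eq_smul_one_of_forall_Octa {m : Matrix (Fin 3) (Fin 3) ℝ}
    (hm : ∀ g ∈ Octa, g * m * gᵀ = m) : m = m 0 0 • (1 : Matrix (Fin 3) (Fin 3) ℝ) := by
  have h₁ := hm !![1, 0, 0; 0, -1, 0; 0, 0, -1] ⟨⟨by
    ext i j; fin_cases i <;> fin_cases j <;> simp [Matrix.mul_apply, Fin.sum_univ_three], by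
    simp [Matrix.det_fin_three]⟩, fun i => ⟨i, by
      fin_cases i
      · left; ext j; fin_cases j <;> simp
      all_goals right; ext j; fin_cases j <;> simp⟩⟩
  have h₂ := hm !![-1, 0, 0; 0, -1, 0; 0, 0, 1] ⟨⟨by
    ext i j; fin_cases i <;> fin_cases j <;> simp [Matrix.mul_apply, Fin.sum_univ_three], by
    simp [Matrix.det_fin_three]⟩, fun i => ⟨i, by
      fin_cases i
      iterate 2 right; ext j; fin_cases j <;> simp
      left; ext j; fin_cases j <;> simp⟩⟩
  have h₃ := hm !![0, 0, 1; 1, 0, 0; 0, 1, 0] ⟨⟨by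
    ext i j; fin_cases i <;> fin_cases j <;> simp [Matrix.mul_apply, Fin.sum_univ_three], by
    simp [Matrix.det_fin_three]⟩, fun i => ⟨i + 1, .inl (by
      ext j; fin_cases i <;> fin_cases j <;> simp)⟩⟩
  rw [← Matrix.ext_iff] at h₁ h₂ h₃
  simp [Matrix.mul_apply, Fin.forall_fin_succ, Fin.sum_univ_three] at h₁ h₂ h₃
  ext i j
  fin_cases i <;> fin_cases j <;> simp <;> grind

lemma eq_trace_smul_one_of_forall_conj {h m : Matrix (Fin 3) (Fin 3) ℝ} (hh : h ∈ SO3)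
    (hm : ∀ g ∈ (fun g => h * g * h⁻¹) '' Octa, g * m * gᵀ = m) :
    m = (m.trace / 3) • (1 : Matrix (Fin 3) (Fin 3) ℝ) := by
  have h' := transpose_mul_of_mem_SO3 hh
  have key := eq_smul_one_of_forall_Octa (m := hᵀ * m * h) fun g hg => by
    have := hm _ ⟨g, hg, rfl⟩
    simp only [inv_eq_transpose_of_mem_SO3 hh, Matrix.transpose_mul,
      Matrix.transpose_transpose] at this
    conv_rhs => rw [← this]
    rw [show hᵀ * (h * g * hᵀ * m * (h * (gᵀ * hᵀ))) * h =
      (hᵀ * h) * (g * (hᵀ * m * h) * gᵀ) * (hᵀ * h) by simp only [Matrix.mul_assoc], h',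
      Matrix.one_mul, Matrix.mul_one]
  set c := (hᵀ * m * h) 0 0
  have hmc : m = c • (1 : Matrix (Fin 3) (Fin 3) ℝ) := by
    calc m = h * (hᵀ * m * h) * hᵀ := by
          rw [show h * (hᵀ * m * h) * hᵀ = (h * hᵀ) * m * (h * hᵀ) by
            simp only [Matrix.mul_assoc], hh.1, Matrix.one_mul, Matrix.mul_one]
      _ = _ := by rw [key, Matrix.mul_smul, Matrix.mul_one, Matrix.smul_mul, hh.1]
  have ht : m.trace = c * 3 := by rw [hmc]; simp
  rw [ht, mul_div_cancel_right₀ _ three_ne_zero]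
  exact hmc

lemma exists_mem_SO3_notMem_Octa : ∃ g ∈ SO3, g ∉ Octa := by
  refine ⟨!![3 / 5, -(4 / 5), 0; 4 / 5, 3 / 5, 0; 0, 0, 1], ⟨?_, ?_⟩, fun ⟨_, h⟩ => ?_⟩
  · ext i j
    fin_cases i <;> fin_cases j <;> simp [Matrix.mul_apply, Fin.sum_univ_three] <;> norm_num
  · simp [Matrix.det_fin_three]; norm_num
  · obtain ⟨j, h | h⟩ := h 0 <;> have := congrFun h 0 <;> fin_cases j <;>
      norm_num [Pi.single_apply] at this

lemma mul_d2_mul_transpose {p : MvPolynomial (Fin 3) ℝ} (hp : p.IsHomogeneous 4)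
    {g : Matrix (Fin 3) (Fin 3) ℝ} (hg : g ∈ SO3) (h : fixesPoly g p) :
    g * d2 p * gᵀ = d2 p := by
  have hs := isSymm_fourthDeriv p
  rw [← gram_fourthDeriv, ← Tensor4.gram_rot (transpose_mul_of_mem_SO3 hg),
    (hs.rot g).ext_form hs fun x => by
      rw [Tensor4.form_rot, (fixesPoly_iff_form hp hg).mp h]]

/-- A harmonic quartic with non-zero isotropic `d₂` has octahedral symmetry group. -/
theorem exists_fixesPoly_iff_mem_Octa {p : MvPolynomial (Fin 3) ℝ} (hp : p.IsHomogeneous 4)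
    (hharm : lap p = 0) {c : ℝ} (hc : d2 p = c • (1 : Matrix (Fin 3) (Fin 3) ℝ))
    (h0 : d2 p ≠ 0) :
    ∃ h ∈ SO3, ∀ g ∈ SO3, fixesPoly g p ↔ hᵀ * g * h ∈ Octa := by
  have hne : fourthDeriv p ≠ 0 := fun hz => h0 <| by
    rw [← gram_fourthDeriv, hz]
    ext i j
    simp [Tensor4.gram]
  obtain ⟨h, hh, A, hA, hform⟩ := Tensor4.exists_cubic_form (isSymm_fourthDeriv p)
    (isTraceless_fourthDeriv hharm) hc hne
  refine ⟨h, hh, fun g hg => ?_⟩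
  have hk : hᵀ * g * h ∈ SO3 := mul_mem_SO3 (mul_mem_SO3 (transpose_mem_SO3 hh) hg) hh
  have hcomm (x) : gᵀ *ᵥ (h *ᵥ x) = h *ᵥ ((hᵀ * g * h)ᵀ *ᵥ x) := by
    simp only [Matrix.mulVec_mulVec, Matrix.transpose_mul, Matrix.transpose_transpose]
    rw [← Matrix.mul_assoc h, hh.1, Matrix.one_mul]
  rw [fixesPoly_iff_form hp hg, mem_Octa_iff hk]
  have hsurj : Function.Surjective fun x => h *ᵥ x := fun x =>
    ⟨hᵀ *ᵥ x, by simp [Matrix.mulVec_mulVec, hh.1]⟩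
  rw [hsurj.forall]
  refine forall_congr' fun x => ?_
  rw [hcomm, hform, hform, mul_right_inj' hA, sq_sum_mulVec_of_mem_SO3 (transpose_mem_SO3 hk),
    sub_left_inj, mul_right_inj' (by norm_num), Fin.sum_univ_three, Fin.sum_univ_three]

/-- Let `E = (H, a, b, λ, μ)` be the harmonic decomposition of an
elasticity tensor, with `H` represented by a harmonic homogeneous degree-4 polynomial `p`,
`a`, `b` traceless symmetric matrices and `λ`, `μ` scalars. Then `E` is cubic (its joint
stabilizer in `SO(3)` is a conjugate of the octahedral group `𝕆`) iff `a = 0`, `b = 0`,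
the deviatoric part of `d₂(p)` vanishes, and `d₂(p) ≠ 0`. -/
theorem elasticity_cubic_iff
    (p : MvPolynomial (Fin 3) ℝ) (hp : p.IsHomogeneous 4) (hharm : lap p = 0)
    (a b : Matrix (Fin 3) (Fin 3) ℝ) (ha : aᵀ = a) (hb : bᵀ = b)
    (ha0 : a.trace = 0) (hb0 : b.trace = 0) (lam mu : ℝ) :
    (∃ h ∈ SO3,
        {g | g ∈ SO3 ∧ fixesPoly g p ∧ g * a * gᵀ = a ∧ g * b * gᵀ = b} =
          (fun g => h * g * h⁻¹) '' Octa) ↔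
      (a = 0 ∧ b = 0 ∧
        d2 p = (((d2 p).trace) / 3) • (1 : Matrix (Fin 3) (Fin 3) ℝ) ∧ d2 p ≠ 0) := by
  constructor
  · rintro ⟨h, hh, hstab⟩
    have hmem (g) (hg : g ∈ (fun g => h * g * h⁻¹) '' Octa) :
        g ∈ SO3 ∧ fixesPoly g p ∧ g * a * gᵀ = a ∧ g * b * gᵀ = b := by
      rwa [← hstab] at hg
    have ha' : a = 0 := by
      rw [eq_trace_smul_one_of_forall_conj hh fun g hg => (hmem g hg).2.2.1, ha0, zero_div,
        zero_smul]
    have hb' : b = 0 := by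
      rw [eq_trace_smul_one_of_forall_conj hh fun g hg => (hmem g hg).2.2.2, hb0, zero_div,
        zero_smul]
    refine ⟨ha', hb', eq_trace_smul_one_of_forall_conj hh fun g hg =>
      mul_d2_mul_transpose hp (hmem g hg).1 (hmem g hg).2.1, fun h0 => ?_⟩
    have hz : fourthDeriv p = 0 := Tensor4.eq_zero_of_gram_eq_zero h0
    obtain ⟨g, hg, hgO⟩ := exists_mem_SO3_notMem_Octa
    have hk : h * g * hᵀ ∈ SO3 := mul_mem_SO3 (mul_mem_SO3 hh hg) (transpose_mem_SO3 hh)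
    have hkO : h * g * hᵀ ∈ (fun g => h * g * h⁻¹) '' Octa := by
      rw [← hstab]
      refine ⟨hk, (fixesPoly_iff_form hp hk).mpr fun x => ?_, by simp [ha'], by simp [hb']⟩
      simp [hz, Tensor4.form]
    rw [mem_image_conj_Octa_iff hh, show hᵀ * (h * g * hᵀ) * h = (hᵀ * h) * g * (hᵀ * h) by
      simp only [Matrix.mul_assoc], transpose_mul_of_mem_SO3 hh, Matrix.one_mul,
      Matrix.mul_one] at hkO
    exact hgO hkO
  · rintro ⟨rfl, rfl, hc, h0⟩
    obtain ⟨h, hh, hiff⟩ := exists_fixesPoly_iff_mem_Octa hp hharm hc h0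
    refine ⟨h, hh, Set.ext fun g => ?_⟩
    rw [mem_image_conj_Octa_iff hh]
    constructor
    · rintro ⟨hg, hfix, -⟩
      exact (hiff g hg).mp hfix
    · intro hO
      have hg : g ∈ SO3 := by
        have := mul_mem_SO3 (mul_mem_SO3 hh hO.1) (transpose_mem_SO3 hh)
        rwa [show h * (hᵀ * g * h) * hᵀ = (h * hᵀ) * g * (h * hᵀ) by
          simp only [Matrix.mul_assoc], hh.1, Matrix.one_mul, Matrix.mul_one] at this
      exact ⟨hg, (hiff g hg).mpr hO, by simp, by simp⟩
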